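/- Suppose conditions (i), (ii), (iii), (iv), (v) and (vi) hold, and let p ≥ 1 satisfy p(α − κ_γ/2) < α. Then there exists a constant C(p) < ∞ such that for every x ∈ ℝ^d, ∫_0^T ∫_{ℝ^d} |ρ(x, x + u b(x) + √u σ(x) z, u)|^p · δ u^{α−1} exp(−δ u^α/α) · (2π)^{−d/2} exp(−‖z‖²/2) dz du ≤ C(p); that is, the p-th moment of the single incremental weight of the copycat CIS algorithm is bounded uniformly in the starting point x. -/

import Mathlib

open MeasureTheory ProbabilityTheory Matrix Real

/-- Partial derivative of a scalar function on `ℝ^d` along the `i`-th coordinate. -/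
noncomputable def pd {d : ℕ} (i : Fin d) (f : (Fin d → ℝ) → ℝ) (x : Fin d → ℝ) : ℝ :=
  deriv (fun t => f (Function.update x i t)) (x i)

/-- Frobenius norm of a `d × d` real matrix. -/
noncomputable def fnorm {d : ℕ} (A : Matrix (Fin d) (Fin d) ℝ) : ℝ :=
  Real.sqrt (∑ i, ∑ j, (A i j) ^ 2)

/-- Euclidean norm of a vector in `ℝ^d`. -/
noncomputable def vnorm {d : ℕ} (v : Fin d → ℝ) : ℝ :=
  Real.sqrt (∑ i, (v i) ^ 2)

lemma vnorm_eq_norm {d : ℕ} (v : Fin d → ℝ) : vnorm v = ‖WithLp.toLp 2 v‖ := by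
  simp [vnorm, EuclideanSpace.norm_eq]

lemma vnorm_nonneg {d : ℕ} (v : Fin d → ℝ) : 0 ≤ vnorm v := Real.sqrt_nonneg _

lemma fnorm_nonneg {d : ℕ} (v : Matrix (Fin d) (Fin d) ℝ) : 0 ≤ fnorm v := Real.sqrt_nonneg _

lemma vnorm_sq {d : ℕ} (v : Fin d → ℝ) : vnorm v ^ 2 = ∑ i, v i ^ 2 :=
  Real.sq_sqrt (Finset.sum_nonneg fun _ _ => sq_nonneg _)

lemma fnorm_sq {d : ℕ} (A : Matrix (Fin d) (Fin d) ℝ) : fnorm A ^ 2 = ∑ i, ∑ j, A i j ^ 2 :=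
  Real.sq_sqrt (Finset.sum_nonneg fun _ _ => Finset.sum_nonneg fun _ _ => sq_nonneg _)

lemma vnorm_add_le {d : ℕ} (v w : Fin d → ℝ) : vnorm (v + w) ≤ vnorm v + vnorm w := by
  simp only [vnorm_eq_norm, WithLp.toLp_add]; exact norm_add_le _ _

lemma vnorm_sub_le {d : ℕ} (v w : Fin d → ℝ) : vnorm (v - w) ≤ vnorm v + vnorm w := by
  simp only [vnorm_eq_norm, WithLp.toLp_sub]; exact norm_sub_le _ _

lemma vnorm_smul {d : ℕ} (a : ℝ) (v : Fin d → ℝ) : vnorm (a • v) = |a| * vnorm v := by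
  simp only [vnorm_eq_norm, WithLp.toLp_smul, norm_smul, Real.norm_eq_abs]

lemma abs_dot_le {d : ℕ} (v w : Fin d → ℝ) : |v ⬝ᵥ w| ≤ vnorm v * vnorm w := by
  apply abs_le_of_sq_le_sq _ (mul_nonneg (vnorm_nonneg _) (vnorm_nonneg _))
  rw [mul_pow, vnorm_sq, vnorm_sq]
  exact Finset.sum_mul_sq_le_sq_mul_sq _ _ _

lemma abs_frob_le {d : ℕ} (A B : Matrix (Fin d) (Fin d) ℝ) :
    |∑ i, ∑ j, A i j * B i j| ≤ fnorm A * fnorm B := by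
  apply abs_le_of_sq_le_sq _ (mul_nonneg (fnorm_nonneg _) (fnorm_nonneg _))
  rw [mul_pow, fnorm_sq, fnorm_sq]
  simp only [← Fintype.sum_prod_type']
  exact Finset.sum_mul_sq_le_sq_mul_sq _ _ _

lemma vnorm_mulVec_le {d : ℕ} (A : Matrix (Fin d) (Fin d) ℝ) (v : Fin d → ℝ) :
    vnorm (A *ᵥ v) ≤ fnorm A * vnorm v := by
  apply abs_le_of_sq_le_sq' _ (mul_nonneg (fnorm_nonneg _) (vnorm_nonneg _)) |>.2
  rw [mul_pow, vnorm_sq, vnorm_sq, fnorm_sq, Finset.sum_mul]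
  refine Finset.sum_le_sum fun i _ => ?_
  simp only [mulVec, dotProduct]
  exact Finset.sum_mul_sq_le_sq_mul_sq _ _ _

lemma fnorm_transpose {d : ℕ} (A : Matrix (Fin d) (Fin d) ℝ) : fnorm Aᵀ = fnorm A := by
  unfold fnorm; rw [Finset.sum_comm]; rfl

lemma vnorm_one {d : ℕ} : vnorm (fun _ : Fin d => (1:ℝ)) = √d := by
  simp [vnorm]

lemma abs_sum_le {d : ℕ} (v : Fin d → ℝ) : |∑ i, v i| ≤ vnorm v * √d := by
  have := abs_dot_le v (fun _ => 1)
  simpa [dotProduct, vnorm_one] using this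

lemma abs_sum_sum_le {d : ℕ} (A : Matrix (Fin d) (Fin d) ℝ) :
    |∑ i, ∑ j, A i j| ≤ fnorm A * d := by
  have := abs_frob_le A (fun _ _ => 1)
  have h : fnorm (fun _ _ : Fin d => (1:ℝ)) = d := by
    simp [fnorm]
  rw [h] at this
  simpa using this

lemma det_isUnit {d : ℕ} (S : Matrix (Fin d) (Fin d) ℝ) (c : ℝ) (hc : 0 < c)
    (h : ∀ z : Fin d → ℝ, c * (z ⬝ᵥ z) ≤ z ⬝ᵥ ((S * Sᵀ) *ᵥ z)) : IsUnit S.det := by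
  rw [isUnit_iff_ne_zero]
  intro h0
  obtain ⟨v, hv, hv0⟩ := Matrix.exists_vecMul_eq_zero_iff.mpr h0
  have := h v
  rw [← Matrix.mulVec_mulVec, Matrix.mulVec_transpose, hv0] at this
  simp only [mulVec_zero, dotProduct_zero] at this
  have h2 : 0 < v ⬝ᵥ v := by
    have := dotProduct_star_self_pos_iff.mpr hv
    simpa using this
  nlinarith [mul_pos hc h2]

lemma fnorm_inv_le {d : ℕ} (S : Matrix (Fin d) (Fin d) ℝ) (c : ℝ) (hc : 0 < c)
    (h : ∀ z : Fin d → ℝ, c * (z ⬝ᵥ z) ≤ z ⬝ᵥ ((S * Sᵀ) *ᵥ z)) : fnorm S⁻¹ ≤ √(d / c) := by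
  have hu := det_isUnit S c hc h
  apply Real.sqrt_le_sqrt
  rw [le_div_iff₀ hc, Finset.sum_mul]
  calc _ ≤ ∑ i : Fin d, (1:ℝ) := by
        refine Finset.sum_le_sum fun i _ => ?_
        have := h (S⁻¹ i)
        rw [← Matrix.mulVec_mulVec, Matrix.mulVec_transpose, Matrix.dotProduct_mulVec] at this
        have e : (S⁻¹ i) ᵥ* S = Pi.single i 1 := by
          have h1 := Matrix.nonsing_inv_mul S hu
          have h2 := congrFun h1 i
          rw [Matrix.mul_apply_eq_vecMul] at h2
          rw [h2]; ext j; simp [Matrix.one_apply, Pi.single_apply, eq_comm]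
        rw [e] at this
        simp only [dotProduct, ← pow_two, Pi.single_apply] at this
        simp at this
        linarith
    _ = d := by simp

/-- The algebraic estimate of the bracket in the incremental weight. -/
lemma bracket_le {d : ℕ} (S D K g1 g2 : Matrix (Fin d) (Fin d) ℝ) (z L bd b1 : Fin d → ℝ)
    (hu : IsUnit S.det) (u C F G W : ℝ) (hu0 : 0 < u)
    (hL : L = -(1 / u) • ((S * Sᵀ)⁻¹ *ᵥ (√u • (S *ᵥ z))))
    (hK : K = vecMulVec L L - (1 / u) • (S * Sᵀ)⁻¹)
    (hF : fnorm (S⁻¹ * D) ≤ F) (hG : fnorm S⁻¹ ≤ G)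
    (hW : vnorm (S⁻¹ *ᵥ bd) ≤ W) (h1 : fnorm g1 ≤ C) (h2 : fnorm g2 ≤ C) (h3 : vnorm b1 ≤ C) :
    |(1 / 2) * ((∑ i, ∑ j, D i j * K i j) + ∑ i, ∑ j, g2 i j)
        + (∑ i, ((∑ j, g1 i j) - bd i) * L i) - ∑ i, b1 i| ≤
      (1 / 2) * ((1 / u) * (F * G * (vnorm z ^ 2 + 1)) + C * d)
        + (1 / √u) * ((G * (C * √d) + W) * vnorm z) + C * √d := by
  have hs : 0 < √u := Real.sqrt_pos.mpr hu0
  have hss : √u * √u = u := Real.mul_self_sqrt hu0.le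
  have hG0 : 0 ≤ G := (fnorm_nonneg _).trans hG
  have hF0 : 0 ≤ F := (fnorm_nonneg _).trans hF
  have hC0 : 0 ≤ C := (fnorm_nonneg _).trans h1
  have hr0 := vnorm_nonneg z
  have hinv : (S * Sᵀ)⁻¹ = (S⁻¹)ᵀ * S⁻¹ := by
    rw [Matrix.mul_inv_rev, Matrix.transpose_nonsing_inv]
  have hL' : L = -(1 / √u) • ((S⁻¹)ᵀ *ᵥ z) := by
    rw [hL, hinv, Matrix.mulVec_smul, ← Matrix.mulVec_mulVec, Matrix.mulVec_mulVec z S⁻¹ S,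
      Matrix.nonsing_inv_mul S hu, Matrix.one_mulVec, smul_smul]
    congr 1
    rw [neg_mul, neg_inj]
    field_simp
    nlinarith
  set w := (S⁻¹)ᵀ *ᵥ z with hw
  have hdot : ∀ v : Fin d → ℝ, v ⬝ᵥ w = (S⁻¹ *ᵥ v) ⬝ᵥ z := by
    intro v
    rw [hw, Matrix.dotProduct_mulVec, Matrix.vecMul_transpose]
  have hwn : vnorm w ≤ G * vnorm z := by
    refine (vnorm_mulVec_le _ _).trans ?_
    rw [fnorm_transpose]; gcongr
  -- term 1
  have hT1 : ∑ i, ∑ j, D i j * K i j =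
      (1 / u) * (z ⬝ᵥ ((S⁻¹ * D) *ᵥ w) - ∑ i, ∑ j, (S⁻¹ * D) i j * S⁻¹ i j) := by
    have e1 : z ⬝ᵥ ((S⁻¹ * D) *ᵥ w) = ∑ i, ∑ j, D i j * (w i * w j) := by
      rw [← Matrix.mulVec_mulVec, dotProduct_comm, ← hdot, dotProduct_comm]
      simp only [dotProduct, mulVec, Finset.mul_sum]
      refine Finset.sum_congr rfl fun i _ => Finset.sum_congr rfl fun j _ => by ring
    have e2 : ∑ i, ∑ j, (S⁻¹ * D) i j * S⁻¹ i j = ∑ i, ∑ j, D i j * ((S⁻¹)ᵀ * S⁻¹) i j := by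
      simp only [Matrix.mul_apply, Finset.sum_mul, Finset.mul_sum, Matrix.transpose_apply]
      rw [Finset.sum_comm]
      conv_rhs => rw [Finset.sum_comm]
      refine Finset.sum_congr rfl fun j _ => ?_
      rw [Finset.sum_comm]
      refine Finset.sum_congr rfl fun j _ => Finset.sum_congr rfl fun k _ => by ring
    rw [e1, e2, ← Finset.sum_sub_distrib, Finset.mul_sum]
    refine Finset.sum_congr rfl fun i _ => ?_
    rw [← Finset.sum_sub_distrib, Finset.mul_sum]
    refine Finset.sum_congr rfl fun j _ => ?_
    have : (1 / √u) * (1 / √u) = 1 / u := by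
      rw [div_mul_div_comm, hss, one_mul]
    rw [hK, hL', hinv]
    simp only [Matrix.sub_apply, vecMulVec_apply, Matrix.smul_apply, Pi.smul_apply, smul_eq_mul]
    rw [← this]; ring
  have hB1 : |∑ i, ∑ j, D i j * K i j| ≤ (1 / u) * (F * G * (vnorm z ^ 2 + 1)) := by
    rw [hT1, abs_mul, abs_of_pos (by positivity : 0 < 1 / u)]
    gcongr
    refine (abs_sub _ _).trans ?_
    have a1 : |z ⬝ᵥ ((S⁻¹ * D) *ᵥ w)| ≤ vnorm z * (F * (G * vnorm z)) := by
      refine (abs_dot_le _ _).trans ?_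
      gcongr
      refine (vnorm_mulVec_le _ _).trans ?_
      gcongr
      exact vnorm_nonneg _
    have a2 : |∑ i, ∑ j, (S⁻¹ * D) i j * S⁻¹ i j| ≤ F * G :=
      (abs_frob_le _ _).trans (mul_le_mul hF hG (fnorm_nonneg _) hF0)
    nlinarith
  -- term 2
  have hB2 : |∑ i, ((∑ j, g1 i j) - bd i) * L i| ≤
      (1 / √u) * ((G * (C * √d) + W) * vnorm z) := by
    have e : ∑ i, ((∑ j, g1 i j) - bd i) * L i
        = -(1 / √u) * ((S⁻¹ *ᵥ (g1 *ᵥ (fun _ => 1)) - S⁻¹ *ᵥ bd) ⬝ᵥ z) := by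
      rw [← Matrix.mulVec_sub, ← hdot, hL']
      simp only [dotProduct, mulVec, Finset.mul_sum, Pi.sub_apply, mul_one, Pi.smul_apply,
        smul_eq_mul]
      refine Finset.sum_congr rfl fun i _ => by ring
    rw [e, abs_mul, abs_neg, abs_of_pos (by positivity : 0 < 1 / √u)]
    gcongr
    refine (abs_dot_le _ _).trans ?_
    gcongr
    refine (vnorm_sub_le _ _).trans ?_
    gcongr
    refine (vnorm_mulVec_le _ _).trans (mul_le_mul hG ?_ (vnorm_nonneg _) hG0)
    refine (vnorm_mulVec_le _ _).trans ?_
    rw [vnorm_one]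
    gcongr
  have hB3 : |∑ i, ∑ j, g2 i j| ≤ C * d := (abs_sum_sum_le _).trans (by gcongr)
  have hB4 : |∑ i, b1 i| ≤ C * √d := (abs_sum_le _).trans (by gcongr)
  rw [abs_le] at *
  constructor <;> linarith [hB1.1, hB1.2, hB2.1, hB2.2, hB3.1, hB3.2, hB4.1, hB4.2]

set_option maxHeartbeats 1000000 in
/-- The scalar estimate. -/
lemma scalar_le (d : ℕ) (C G T κb κ m : ℝ) (hC : 0 ≤ C) (hG : 0 ≤ G) (hT : 0 < T) (hκb : 0 < κb)
    (hκ0 : 0 < κ) (hκ1 : κ ≤ 1) (hm : κ < m) :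
    ∃ A N : ℝ, 0 ≤ A ∧ 0 ≤ N ∧ ∀ u r V : ℝ, 0 < u → u < T → 0 ≤ r → 0 ≤ V →
      V ≤ √u * (C * √T + r) →
      (1 / 2) * ((1 / u) * (C * (V ^ κ + V ^ m) * G * (r ^ 2 + 1)) + C * d)
        + (1 / √u) * ((G * (C * √d) + C * (1 + V ^ κb)) * r) + C * √d
      ≤ A * u ^ (κ / 2 - 1) * Real.exp (N * r) := by
  set B := C * √T + 1 with hB
  have hB0 : 0 < B := by positivity
  have hsT : 0 < √T := Real.sqrt_pos.mpr hT
  refine ⟨C * (B ^ κ + √T ^ (m - κ) * B ^ m) * G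
      + (G * (C * √d) + C * (1 + √T ^ κb * B ^ κb)) * T ^ ((1 - κ) / 2)
      + (C * d / 2 + C * √d) * T ^ (1 - κ / 2), m + κb + 3, by positivity, by linarith, ?_⟩
  intro u r V hu huT hr hV hVle
  have hs : 0 < √u := Real.sqrt_pos.mpr hu
  have hsu : √u ≤ √T := Real.sqrt_le_sqrt huT.le
  have hr1 : 1 + r ≤ Real.exp r := by linarith [Real.add_one_le_exp r]
  have hre : r ≤ Real.exp r := by linarith
  have hVB : V ≤ √u * B * Real.exp r := by
    refine hVle.trans ?_
    rw [mul_assoc]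
    gcongr
    have : C * √T + r ≤ B * (1 + r) := by
      rw [hB]; nlinarith [mul_nonneg (mul_nonneg hC hsT.le) hr]
    exact this.trans (by gcongr)
  have hVk : ∀ k : ℝ, 0 < k → V ^ k ≤ √u ^ k * B ^ k * Real.exp (k * r) := by
    intro k hk
    refine (Real.rpow_le_rpow hV hVB hk.le).trans (le_of_eq ?_)
    rw [Real.mul_rpow (by positivity) (by positivity), Real.mul_rpow (by positivity) (by positivity),
      ← Real.exp_mul, mul_comm r k]
  have hP : 0 < u ^ (κ / 2 - 1) := by positivity
  set P := u ^ (κ / 2 - 1) with hPdef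
  have hsr : ∀ k : ℝ, √u ^ k = u ^ (k / 2) := by
    intro k
    rw [Real.sqrt_eq_rpow, ← Real.rpow_mul hu.le]; congr 1; ring
  -- powers of u
  have p1 : (1 / u) * √u ^ κ = P := by
    rw [hsr, hPdef, Real.rpow_sub hu, Real.rpow_one]; ring
  have p2 : (1 / u) * √u ^ m ≤ P * √T ^ (m - κ) := by
    rw [← p1, mul_assoc]
    gcongr
    calc √u ^ m = √u ^ κ * √u ^ (m - κ) := by rw [← Real.rpow_add hs]; congr 1; ring
      _ ≤ _ := by gcongr
  have p3 : 1 / √u ≤ P * T ^ ((1 - κ) / 2) := by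
    calc 1 / √u = P * u ^ ((1 - κ) / 2) := by
          rw [hPdef, ← Real.rpow_add hu, Real.sqrt_eq_rpow, one_div, ← Real.rpow_neg hu.le]
          congr 1; ring
      _ ≤ _ := by gcongr
  have p4 : 1 ≤ P * T ^ (1 - κ / 2) := by
    calc 1 = P * u ^ (1 - κ / 2) := by
          rw [hPdef, ← Real.rpow_add hu]; 
          rw [show κ / 2 - 1 + (1 - κ / 2) = 0 by ring, Real.rpow_zero]
      _ ≤ _ := by gcongr; linarith
  set E := Real.exp ((m + κb + 3) * r) with hE
  have hm0 : 0 < m := hκ0.trans hm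
  have hE0 : 0 < E := Real.exp_pos _
  have hE1 : 1 ≤ E := Real.one_le_exp (by positivity)
  -- term 1
  have hVsum : (1 / u) * (V ^ κ + V ^ m) ≤
      P * (B ^ κ + √T ^ (m - κ) * B ^ m) * Real.exp (m * r) := by
    have q1 : (1 / u) * V ^ κ ≤ P * B ^ κ * Real.exp (m * r) := by
      calc (1 / u) * V ^ κ ≤ (1 / u) * (√u ^ κ * B ^ κ * Real.exp (κ * r)) := by
            gcongr; exact hVk κ hκ0
        _ = P * B ^ κ * Real.exp (κ * r) := by rw [← p1]; ring
        _ ≤ _ := by gcongr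
    have q2 : (1 / u) * V ^ m ≤ P * (√T ^ (m - κ) * B ^ m) * Real.exp (m * r) := by
      calc (1 / u) * V ^ m ≤ (1 / u) * (√u ^ m * B ^ m * Real.exp (m * r)) := by
            gcongr; exact hVk m (hκ0.trans hm)
        _ = ((1 / u) * √u ^ m) * B ^ m * Real.exp (m * r) := by ring
        _ ≤ (P * √T ^ (m - κ)) * B ^ m * Real.exp (m * r) := by gcongr
        _ = _ := by ring
    nlinarith
  have hr2 : r ^ 2 + 1 ≤ 2 * Real.exp (2 * r) := by
    have h1 : Real.exp (2 * r) = Real.exp r ^ 2 := by rw [← Real.exp_nat_mul]; norm_num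
    have h2 : 1 ≤ Real.exp r := by linarith
    rw [h1]; nlinarith
  have t1 : (1 / 2) * ((1 / u) * (C * (V ^ κ + V ^ m) * G * (r ^ 2 + 1))) ≤
      C * (B ^ κ + √T ^ (m - κ) * B ^ m) * G * P * E := by
    calc _ = (1 / 2) * C * G * ((1 / u) * (V ^ κ + V ^ m)) * (r ^ 2 + 1) := by ring
      _ ≤ (1 / 2) * C * G * (P * (B ^ κ + √T ^ (m - κ) * B ^ m) * Real.exp (m * r))
          * (2 * Real.exp (2 * r)) := by gcongr
      _ = C * (B ^ κ + √T ^ (m - κ) * B ^ m) * G * P * (Real.exp (m * r) * Real.exp (2 * r)) := by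
          ring
      _ ≤ _ := by
          rw [← Real.exp_add, hE]
          have : 0 < m := hκ0.trans hm
          gcongr
          linarith [mul_nonneg this.le hr, mul_nonneg hκb.le hr]
  have t2 : (1 / √u) * ((G * (C * √d) + C * (1 + V ^ κb)) * r) ≤
      (G * (C * √d) + C * (1 + √T ^ κb * B ^ κb)) * T ^ ((1 - κ) / 2) * P * E := by
    have hek : 1 ≤ Real.exp (κb * r) := Real.one_le_exp (by positivity)
    have v1 : V ^ κb ≤ √T ^ κb * B ^ κb * Real.exp (κb * r) :=
      (hVk κb hκb).trans (by gcongr)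
    have v2 : G * (C * √d) + C * (1 + V ^ κb) ≤
        (G * (C * √d) + C * (1 + √T ^ κb * B ^ κb)) * Real.exp (κb * r) := by
      calc _ ≤ G * (C * √d) * 1 + C * (1 * 1 + √T ^ κb * B ^ κb * Real.exp (κb * r)) := by
            simp only [mul_one]; gcongr
        _ ≤ G * (C * √d) * Real.exp (κb * r)
            + C * (1 * Real.exp (κb * r) + √T ^ κb * B ^ κb * Real.exp (κb * r)) := by gcongr
        _ = _ := by ring
    calc _ ≤ (P * T ^ ((1 - κ) / 2)) * (((G * (C * √d) + C * (1 + √T ^ κb * B ^ κb))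
          * Real.exp (κb * r)) * Real.exp r) := by gcongr
      _ = (G * (C * √d) + C * (1 + √T ^ κb * B ^ κb)) * T ^ ((1 - κ) / 2) * P *
          (Real.exp (κb * r) * Real.exp r) := by ring
      _ ≤ _ := by
          rw [← Real.exp_add, hE]
          have : 0 < m := hκ0.trans hm
          gcongr
          linarith [mul_nonneg this.le hr, mul_nonneg hκb.le hr]
  have t3 : C * d / 2 + C * √d ≤ (C * d / 2 + C * √d) * T ^ (1 - κ / 2) * P * E := by
    have : 1 ≤ (P * T ^ (1 - κ / 2)) * E :=
      one_le_mul_of_one_le_of_one_le p4 hE1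
    calc _ = (C * d / 2 + C * √d) * 1 := by ring
      _ ≤ (C * d / 2 + C * √d) * ((P * T ^ (1 - κ / 2)) * E) := by gcongr
      _ = _ := by ring
  linarith

lemma gauss_finite (d : ℕ) (M : ℝ) :
    ∫⁻ z : Fin d → ℝ, ENNReal.ofReal (Real.exp (M * vnorm z) * Real.exp (-(vnorm z) ^ 2 / 2)) < ⊤ := by
  have hint : Integrable (fun z : Fin d → ℝ => ∏ i, Real.exp (-(1 / 4) * (z i) ^ 2)) := by
    exact Integrable.fintype_prod (f := fun _ t => Real.exp (-(1 / 4) * t ^ 2))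
      (fun i => integrable_exp_neg_mul_sq (by norm_num))
  have hint2 := hint.const_mul (Real.exp (M ^ 2))
  refine lt_of_le_of_lt (lintegral_mono fun z => ?_) hint2.lintegral_lt_top
  apply ENNReal.ofReal_le_ofReal
  rw [← Real.exp_sum, ← Finset.mul_sum, ← vnorm_sq, ← Real.exp_add, ← Real.exp_add]
  apply Real.exp_le_exp.mpr
  nlinarith [sq_nonneg (vnorm z / 2 - M)]

lemma time_finite (T α β : ℝ) (hα : 0 < α) (hβ : 0 < β) :
    ∫⁻ u in Set.Ioo (0:ℝ) T, ENNReal.ofReal (u ^ (α - 1) + u ^ (β - 1)) < ⊤ := by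
  rcases le_or_gt T 0 with hT | hT
  · simp [Set.Ioo_eq_empty (not_lt.mpr hT)]
  have h : ∀ s : ℝ, 0 < s → IntegrableOn (fun u : ℝ => u ^ (s - 1)) (Set.Ioo 0 T) := fun s hs =>
    (intervalIntegral.integrableOn_Ioo_rpow_iff hT).mpr (by linarith)
  exact ((h α hα).add (h β hβ)).lintegral_lt_top

lemma real_add_rpow_le {a b p : ℝ} (ha : 0 ≤ a) (hb : 0 ≤ b) (hp : 1 ≤ p) :
    (a + b) ^ p ≤ 2 ^ (p - 1) * (a ^ p + b ^ p) := by
  lift a to NNReal using ha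
  lift b to NNReal using hb
  exact_mod_cast NNReal.rpow_add_le_mul_rpow_add_rpow a b hp

/-- **Uniform boundedness of the `p`-th moment of the single incremental weight of the
copycat CIS algorithm, case (a)** (Proposition 6.9(a) of the paper). -/
theorem copycat_cis_incremental_moment_bound_gamma
    {d : ℕ} (hd : 1 ≤ d)
    (b : (Fin d → ℝ) → (Fin d → ℝ)) (σ : (Fin d → ℝ) → Matrix (Fin d) (Fin d) ℝ)
    (γ : (Fin d → ℝ) → Matrix (Fin d) (Fin d) ℝ)
    (hγdef : ∀ x, γ x = σ x * (σ x)ᵀ)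
    -- derived functions
    (b1 : (Fin d → ℝ) → Fin d → ℝ)
    (hb1 : ∀ x i, b1 x i = pd i (fun y => b y i) x)
    (γ1 γ2 : (Fin d → ℝ) → Matrix (Fin d) (Fin d) ℝ)
    (hγ1 : ∀ x i j, γ1 x i j = pd j (fun y => γ y i j) x)
    (hγ2 : ∀ x i j, γ2 x i j = pd i (fun y => pd j (fun y' => γ y' i j) y) x)
    -- conditions (i)-(vi)
    (C : ℝ) (κb : ℝ) (hκb : 0 < κb)
    (hcond_i : ∀ x y, vnorm ((σ x)⁻¹ *ᵥ (b y - b x)) ≤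
      C * (1 + vnorm ((σ x)⁻¹ *ᵥ (y - x)) ^ κb))
    (hcond_ii : ∀ x, vnorm ((σ x)⁻¹ *ᵥ b x) ≤ C)
    (hcond_iii_ex : ∀ x i, DifferentiableAt ℝ (fun t => b (Function.update x i t) i) (x i))
    (hcond_iii : ∀ x, vnorm (b1 x) ≤ C)
    (hcond_iv_ex1 : ∀ x i j,
      DifferentiableAt ℝ (fun t => γ (Function.update x j t) i j) (x j))
    (hcond_iv_ex2 : ∀ x i j,
      DifferentiableAt ℝ (fun t => pd j (fun y => γ y i j) (Function.update x i t)) (x i))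
    (hcond_iv1 : ∀ x, fnorm (γ1 x) ≤ C)
    (hcond_iv2 : ∀ x, fnorm (γ2 x) ≤ C)
    (c : ℝ) (hc : 0 < c)
    (hcond_v : ∀ x z, c * (z ⬝ᵥ z) ≤ z ⬝ᵥ (γ x *ᵥ z))
    (κγ m : ℝ) (hκγ0 : 0 < κγ) (hκγ1 : κγ ≤ 1) (hm : κγ < m)
    (hcond_vi : ∀ x y, fnorm ((σ x)⁻¹ * (γ y - γ x)) ≤
      C * (vnorm ((σ x)⁻¹ *ᵥ (y - x)) ^ κγ + vnorm ((σ x)⁻¹ *ᵥ (y - x)) ^ m))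
    (T δ α : ℝ) (hT : 0 < T) (hδ : 0 < δ) (hα0 : 0 < α) (hα1 : α < 1)
    -- incremental weight
    (Λ : (Fin d → ℝ) → (Fin d → ℝ) → ℝ → (Fin d → ℝ))
    (hΛ : ∀ x y u, Λ x y u = -(1 / u) • ((γ x)⁻¹ *ᵥ (y - x - u • b x)))
    (Ktil : (Fin d → ℝ) → (Fin d → ℝ) → ℝ → Matrix (Fin d) (Fin d) ℝ)
    (hKtil : ∀ x y u, Ktil x y u = vecMulVec (Λ x y u) (Λ x y u) - (1 / u) • (γ x)⁻¹)
    (ρ : (Fin d → ℝ) → (Fin d → ℝ) → ℝ → ℝ)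
    (hρ : ∀ x y u, ρ x y u = 1 + (1 / (δ * u ^ (α - 1))) *
      ((1 / 2) * ((∑ i, ∑ j, (γ y i j - γ x i j) * Ktil x y u i j)
          + ∑ i, ∑ j, γ2 y i j)
        + (∑ i, ((∑ j, γ1 y i j) - b y i + b x i) * Λ x y u i)
        - ∑ i, b1 y i))
    (p : ℝ) (hp : 1 ≤ p) (hpα : p * (α - κγ / 2) < α) :
    ∃ Cp : ℝ, ∀ x : Fin d → ℝ,
      (∫⁻ u in Set.Ioo (0 : ℝ) T, ∫⁻ z : Fin d → ℝ,
        ENNReal.ofReal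
          (|ρ x (x + u • b x + Real.sqrt u • (σ x *ᵥ z)) u| ^ p
            * (δ * u ^ (α - 1) * Real.exp (-δ * u ^ α / α))
            * ((2 * π) ^ (-(d : ℝ) / 2) * Real.exp (-(vnorm z) ^ 2 / 2)))) ≤
        ENNReal.ofReal Cp := by
  have hC : 0 ≤ C := (vnorm_nonneg _).trans (hcond_ii 0)
  have hv' : ∀ x (z : Fin d → ℝ), c * (z ⬝ᵥ z) ≤ z ⬝ᵥ ((σ x * (σ x)ᵀ) *ᵥ z) := by
    intro x z; rw [← hγdef]; exact hcond_v x z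
  obtain ⟨A, N, hA, hN, hAN⟩ := scalar_le d C (√(d / c)) T κb κγ m hC (Real.sqrt_nonneg _) hT hκb
    hκγ0 hκγ1 hm
  -- pointwise bound
  have hpt : ∀ x u (z : Fin d → ℝ), 0 < u → u < T →
      |ρ x (x + u • b x + √u • (σ x *ᵥ z)) u| ≤
        (1 + A / δ) * (1 + u ^ (κγ / 2 - α)) * Real.exp (N * vnorm z) := by
    intro x u z hu huT
    set y := x + u • b x + √u • (σ x *ᵥ z) with hy
    have hdet := det_isUnit (σ x) c hc (hv' x)
    have hG := fnorm_inv_le (σ x) c hc (hv' x)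
    have hs : 0 < √u := Real.sqrt_pos.mpr hu
    have hV : vnorm ((σ x)⁻¹ *ᵥ (y - x)) ≤ √u * (C * √T + vnorm z) := by
      have e : (σ x)⁻¹ *ᵥ (y - x) = u • ((σ x)⁻¹ *ᵥ b x) + √u • z := by
        rw [show y - x = u • b x + √u • (σ x *ᵥ z) by rw [hy]; abel, Matrix.mulVec_add,
          Matrix.mulVec_smul, Matrix.mulVec_smul, Matrix.mulVec_mulVec,
          Matrix.nonsing_inv_mul _ hdet, Matrix.one_mulVec]
      rw [e]
      refine (vnorm_add_le _ _).trans ?_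
      rw [vnorm_smul, vnorm_smul, abs_of_pos hu, abs_of_pos hs]
      have h1 : u * vnorm ((σ x)⁻¹ *ᵥ b x) ≤ √u * (C * √T) := by
        calc _ ≤ u * C := by gcongr; exact hcond_ii x
          _ = √u * (C * √u) := by nlinarith [Real.mul_self_sqrt hu.le]
          _ ≤ _ := by gcongr
      linarith
    have hbr := bracket_le (σ x) (γ y - γ x) (Ktil x y u) (γ1 y) (γ2 y) z (Λ x y u) (b y - b x)
      (b1 y) hdet u C _ _ _ hu
      (by rw [hΛ, hγdef]; congr 3; rw [hy]; abel)
      (by rw [hKtil, hγdef]) (hcond_vi x y) hG (hcond_i x y) (hcond_iv1 y) (hcond_iv2 y)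
      (hcond_iii y)
    have hsc := hbr.trans (hAN u (vnorm z) _ hu huT (vnorm_nonneg _) (vnorm_nonneg _) hV)
    simp only [Matrix.sub_apply, Pi.sub_apply, ← sub_add] at hsc
    rw [hρ]
    refine (abs_add_le _ _).trans ?_
    rw [abs_mul, abs_one, abs_of_pos (by positivity : 0 < 1 / (δ * u ^ (α - 1)))]
    have hP : (0:ℝ) < u ^ (κγ / 2 - α) := by positivity
    have hE1 : 1 ≤ Real.exp (N * vnorm z) :=
      Real.one_le_exp (mul_nonneg hN (vnorm_nonneg _))
    calc _ ≤ 1 + 1 / (δ * u ^ (α - 1)) *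
          (A * u ^ (κγ / 2 - 1) * Real.exp (N * vnorm z)) := by gcongr
      _ = 1 + A / δ * u ^ (κγ / 2 - α) * Real.exp (N * vnorm z) := by
          have : u ^ (κγ / 2 - α) = u ^ (κγ / 2 - 1) / u ^ (α - 1) := by
            rw [← Real.rpow_sub hu]; congr 1; ring
          rw [this]; field_simp
      _ ≤ 1 * Real.exp (N * vnorm z) + A / δ * u ^ (κγ / 2 - α) * Real.exp (N * vnorm z) := by
          linarith
      _ ≤ _ := by
          rw [← add_mul]
          gcongr
          have : 0 ≤ A / δ := by positivity
          nlinarith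
  set β := (κγ / 2 - α) * p + α with hβdef
  have hβ : 0 < β := by rw [hβdef]; nlinarith
  have hI1 := time_finite T α β hα0 hβ
  have hI2 := gauss_finite d (N * p)
  set I1 := ∫⁻ u in Set.Ioo (0:ℝ) T, ENNReal.ofReal (u ^ (α - 1) + u ^ (β - 1)) with hI1d
  set I2 := ∫⁻ z : Fin d → ℝ,
    ENNReal.ofReal (Real.exp (N * p * vnorm z) * Real.exp (-(vnorm z) ^ 2 / 2)) with hI2d
  set Q := (1 + A / δ) ^ p * 2 ^ (p - 1) * δ * (2 * π) ^ (-(d : ℝ) / 2) with hQ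
  have hQ0 : 0 ≤ Q := by positivity
  refine ⟨(ENNReal.ofReal Q * I1 * I2).toReal, fun x => ?_⟩
  rw [ENNReal.ofReal_toReal (by finiteness)]
  calc _ ≤ ∫⁻ u in Set.Ioo (0 : ℝ) T, ∫⁻ z : Fin d → ℝ,
        (ENNReal.ofReal Q * ENNReal.ofReal (u ^ (α - 1) + u ^ (β - 1))) *
        ENNReal.ofReal (Real.exp (N * p * vnorm z) * Real.exp (-(vnorm z) ^ 2 / 2)) := by
        refine setLIntegral_mono' measurableSet_Ioo fun u hu => lintegral_mono fun z => ?_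
        obtain ⟨hu, huT⟩ := hu
        rw [← ENNReal.ofReal_mul hQ0, ← ENNReal.ofReal_mul (by positivity)]
        apply ENNReal.ofReal_le_ofReal
        have h1 : |ρ x (x + u • b x + √u • (σ x *ᵥ z)) u| ^ p ≤
            (1 + A / δ) ^ p * (2 ^ (p - 1) * (1 + u ^ ((κγ / 2 - α) * p))) *
              Real.exp (N * p * vnorm z) := by
          refine (Real.rpow_le_rpow (abs_nonneg _) (hpt x u z hu huT) (by linarith)).trans ?_
          rw [Real.mul_rpow (by positivity) (by positivity),
            Real.mul_rpow (by positivity) (by positivity), ← Real.exp_mul,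
            show N * vnorm z * p = N * p * vnorm z by ring, Real.rpow_mul hu.le]
          gcongr
          have := real_add_rpow_le (a := 1) (b := u ^ (κγ / 2 - α)) (p := p)
            zero_le_one (by positivity) hp
          simpa using this
        have h2 : Real.exp (-δ * u ^ α / α) ≤ 1 := by
          apply Real.exp_le_one_iff.mpr
          apply div_nonpos_of_nonpos_of_nonneg _ hα0.le
          have : 0 < u ^ α := by positivity
          nlinarith
        have h3 : u ^ (β - 1) = u ^ ((κγ / 2 - α) * p) * u ^ (α - 1) := by
          rw [← Real.rpow_add hu]; congr 1; rw [hβdef]; ring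
        calc _ ≤ ((1 + A / δ) ^ p * (2 ^ (p - 1) * (1 + u ^ ((κγ / 2 - α) * p))) *
              Real.exp (N * p * vnorm z)) * (δ * u ^ (α - 1) * 1) *
              ((2 * π) ^ (-(d : ℝ) / 2) * Real.exp (-(vnorm z) ^ 2 / 2)) := by gcongr
          _ = _ := by rw [h3, hQ]; ring
    _ = ∫⁻ u in Set.Ioo (0 : ℝ) T,
        ENNReal.ofReal Q * ENNReal.ofReal (u ^ (α - 1) + u ^ (β - 1)) * I2 := by
        refine lintegral_congr fun u => ?_
        rw [lintegral_const_mul' _ _ (by finiteness)]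
    _ = _ := by
        rw [lintegral_mul_const' _ _ hI2.ne, lintegral_const_mul' _ _ (by finiteness)]
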